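/- Conversely, given any real numbers η_{ab}, τ_{ab} (0 ≤ a < b ≤ N), α_k (1 ≤ k ≤ N) and β_{kl} (1 ≤ k < l ≤ N) satisfying ω_k·β_{kl} = 0 and ω_l·β_{kl} = 0, the unique alternating bilinear form ξ on su_ω(N+1) whose values on basis pairs are: for a < b < c: ξ(J_{ab},J_{ac}) = ξ(M_{ab},M_{ac}) = ω_{ab}η_{bc}, ξ(J_{ab},J_{bc}) = −η_{ac}, ξ(M_{ab},M_{bc}) = η_{ac}, ξ(J_{ac},J_{bc}) = ξ(M_{ac},M_{bc}) = ω_{bc}η_{ab}, ξ(J_{ab},M_{ac}) = ω_{ab}τ_{bc}, ξ(M_{ab},J_{ac}) = −ω_{ab}τ_{bc}, ξ(J_{ab},M_{bc}) = ξ(M_{ab},J_{bc}) = −τ_{ac}, ξ(J_{ac},M_{bc}) = −ω_{bc}τ_{ab}, ξ(M_{ac},J_{bc}) = ω_{bc}τ_{ab}; ξ(J_{ab},J_{de}) = ξ(M_{ab},M_{de}) = ξ(J_{ab},M_{de}) = 0 for disjoint index pairs; ξ(J_{ab},B_l) = κ_{ab,l}·τ_{ab}, ξ(M_{ab},B_l)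 = −κ_{ab,l}·η_{ab}; ξ(J_{ab},M_{ab}) = Σ_{s=a+1}^{b} ω_{a,s−1}ω_{s,b}·α_s; ξ(B_k,B_l) = β_{kl}, is a 2-cocycle on su_ω(N+1). -/

import Mathlib

open Finset

noncomputable section

/-- `ckW ω a b` is the product `ω_{ab} = ω_{a+1} ω_{a+2} ⋯ ω_b` (so `ckW ω a a = 1`). -/
def ckW (ω : ℕ → ℝ) (a b : ℕ) : ℝ := ∏ s ∈ Finset.Icc (a + 1) b, ω s

/-- `ckKappa a b l = δ_{a,l-1} − δ_{b,l-1} + δ_{b,l} − δ_{a,l}`. -/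
def ckKappa (a b l : ℕ) : ℝ :=
  (if a = l - 1 then (1 : ℝ) else 0) - (if b = l - 1 then (1 : ℝ) else 0)
    + (if b = l then (1 : ℝ) else 0) - (if a = l then (1 : ℝ) else 0)

/-- A 2-cocycle on a real Lie algebra: an alternating bilinear form satisfying the
cocycle identity. -/
def IsLieCocycle {L : Type*} [LieRing L] [LieAlgebra ℝ L]
    (ξ : L →ₗ[ℝ] L →ₗ[ℝ] ℝ) : Prop :=
  (∀ x, ξ x x = 0) ∧ ∀ x y z, ξ ⁅x, y⁆ z + ξ ⁅y, z⁆ x + ξ ⁅z, x⁆ y = 0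

/-- A 2-coboundary on a real Lie algebra: the bilinear form `(x, y) ↦ μ ⁅x, y⁆` for a
linear functional `μ`. -/
def IsLieCoboundary {L : Type*} [LieRing L] [LieAlgebra ℝ L]
    (ξ : L →ₗ[ℝ] L →ₗ[ℝ] ℝ) : Prop :=
  ∃ μ : L →ₗ[ℝ] ℝ, ∀ x y, ξ x y = μ ⁅x, y⁆

/-- The commutation relations of the special unitary Cayley–Klein algebra `su_ω(N+1)`
for the generating family `J, M, B`. -/
structure SUBrackets {L : Type*} [LieRing L] [LieAlgebra ℝ L] (N : ℕ) (ω : ℕ → ℝ)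
    (J M : ℕ → ℕ → L) (B : ℕ → L) : Prop where
  jj_left : ∀ a b c, a < b → b < c → c ≤ N → ⁅J a b, J a c⁆ = ckW ω a b • J b c
  jj_mid : ∀ a b c, a < b → b < c → c ≤ N → ⁅J a b, J b c⁆ = -(J a c)
  jj_right : ∀ a b c, a < b → b < c → c ≤ N → ⁅J a c, J b c⁆ = ckW ω b c • J a b
  mm_left : ∀ a b c, a < b → b < c → c ≤ N → ⁅M a b, M a c⁆ = ckW ω a b • J b c
  mm_mid : ∀ a b c, a < b → b < c → c ≤ N → ⁅M a b, M b c⁆ = J a c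
  mm_right : ∀ a b c, a < b → b < c → c ≤ N → ⁅M a c, M b c⁆ = ckW ω b c • J a b
  jm_left : ∀ a b c, a < b → b < c → c ≤ N → ⁅J a b, M a c⁆ = ckW ω a b • M b c
  jm_mid : ∀ a b c, a < b → b < c → c ≤ N → ⁅J a b, M b c⁆ = -(M a c)
  jm_right : ∀ a b c, a < b → b < c → c ≤ N → ⁅J a c, M b c⁆ = -(ckW ω b c • M a b)
  mj_left : ∀ a b c, a < b → b < c → c ≤ N → ⁅M a b, J a c⁆ = -(ckW ω a b • M b c)
  mj_mid : ∀ a b c, a < b → b < c → c ≤ N → ⁅M a b, J b c⁆ = -(M a c)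
  mj_right : ∀ a b c, a < b → b < c → c ≤ N → ⁅M a c, J b c⁆ = ckW ω b c • M a b
  jj_disj : ∀ a b d e, a < b → b ≤ N → d < e → e ≤ N →
    a ≠ d → a ≠ e → b ≠ d → b ≠ e → ⁅J a b, J d e⁆ = 0
  mm_disj : ∀ a b d e, a < b → b ≤ N → d < e → e ≤ N →
    a ≠ d → a ≠ e → b ≠ d → b ≠ e → ⁅M a b, M d e⁆ = 0
  jm_disj : ∀ a b d e, a < b → b ≤ N → d < e → e ≤ N →
    a ≠ d → a ≠ e → b ≠ d → b ≠ e → ⁅J a b, M d e⁆ = 0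
  jb : ∀ a b l, a < b → b ≤ N → 1 ≤ l → l ≤ N → ⁅J a b, B l⁆ = ckKappa a b l • M a b
  mb : ∀ a b l, a < b → b ≤ N → 1 ≤ l → l ≤ N → ⁅M a b, B l⁆ = -(ckKappa a b l • J a b)
  jm_same : ∀ a b, a < b → b ≤ N →
    ⁅J a b, M a b⁆ = (-(2 * ckW ω a b)) • ∑ s ∈ Finset.Icc (a + 1) b, B s
  bb : ∀ k l, 1 ≤ k → k < l → l ≤ N → ⁅B k, B l⁆ = 0

/-- Index predicate for the basis of `su_ω(N+1)`. -/
def suIdxP (N : ℕ) : (ℕ × ℕ) ⊕ ((ℕ × ℕ) ⊕ ℕ) → Prop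
  | Sum.inl (a, b) => a < b ∧ b ≤ N
  | Sum.inr (Sum.inl (a, b)) => a < b ∧ b ≤ N
  | Sum.inr (Sum.inr l) => 1 ≤ l ∧ l ≤ N

/-- Index type for the basis of `su_ω(N+1)`. -/
def SUIdx (N : ℕ) : Type := {x // suIdxP N x}

/-- The basis family `{J_{ab}} ∪ {M_{ab}} ∪ {B_l}` of `su_ω(N+1)`. -/
def suFam {L : Type*} (N : ℕ) (J M : ℕ → ℕ → L) (B : ℕ → L) : SUIdx N → L :=
  fun x =>
    match x.1 with
    | Sum.inl (a, b) => J a b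
    | Sum.inr (Sum.inl (a, b)) => M a b
    | Sum.inr (Sum.inr l) => B l

/-- The family `{J_{ab}} ∪ {M_{ab}} ∪ {B_l}` is a basis of `L`. -/
def SUBasis {L : Type*} [LieRing L] [LieAlgebra ℝ L] (N : ℕ)
    (J M : ℕ → ℕ → L) (B : ℕ → L) : Prop :=
  LinearIndependent ℝ (suFam N J M B) ∧
    ⊤ ≤ Submodule.span ℝ (Set.range (suFam N J M B))

/-- The extra central generator `I` of `u_ω(N+1)` commutes with everything. -/
structure UCentral {L : Type*} [LieRing L] [LieAlgebra ℝ L] (N : ℕ)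
    (J M : ℕ → ℕ → L) (B : ℕ → L) (I : L) : Prop where
  jcen : ∀ a b, a < b → b ≤ N → ⁅J a b, I⁆ = 0
  mcen : ∀ a b, a < b → b ≤ N → ⁅M a b, I⁆ = 0
  bcen : ∀ l, 1 ≤ l → l ≤ N → ⁅B l, I⁆ = 0

/-- Index type for the basis of `u_ω(N+1)`. -/
def UIdx (N : ℕ) : Type := SUIdx N ⊕ Unit

/-- The basis family `{J_{ab}} ∪ {M_{ab}} ∪ {B_l} ∪ {I}` of `u_ω(N+1)`. -/
def uFam {L : Type*} (N : ℕ) (J M : ℕ → ℕ → L) (B : ℕ → L) (I : L) : UIdx N → L :=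
  Sum.elim (suFam N J M B) fun _ => I

/-- The family `{J_{ab}} ∪ {M_{ab}} ∪ {B_l} ∪ {I}` is a basis of `L`. -/
def UBasis {L : Type*} [LieRing L] [LieAlgebra ℝ L] (N : ℕ)
    (J M : ℕ → ℕ → L) (B : ℕ → L) (I : L) : Prop :=
  LinearIndependent ℝ (uFam N J M B I) ∧
    ⊤ ≤ Submodule.span ℝ (Set.range (uFam N J M B I))

/-- Ordered configurations of two index pairs. -/
theorem pair_cases (N a b d e : ℕ) (hab : a < b) (hb : b ≤ N) (hde : d < e) (he : e ≤ N) :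
    (a = d ∧ b = e) ∨ (a ≠ d ∧ a ≠ e ∧ b ≠ d ∧ b ≠ e) ∨
    ∃ x y z, x < y ∧ y < z ∧ z ≤ N ∧
      ((a = x ∧ b = y ∧ d = x ∧ e = z) ∨ (a = x ∧ b = z ∧ d = x ∧ e = y) ∨
       (a = x ∧ b = y ∧ d = y ∧ e = z) ∨ (a = y ∧ b = z ∧ d = x ∧ e = y) ∨
       (a = x ∧ b = z ∧ d = y ∧ e = z) ∨ (a = y ∧ b = z ∧ d = x ∧ e = z)) := by
  by_cases h1 : a = d
  · rcases lt_trichotomy b e with h | h | h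
    · exact Or.inr (Or.inr ⟨a, b, e, hab, h, he, by omega⟩)
    · exact Or.inl ⟨h1, h⟩
    · exact Or.inr (Or.inr ⟨a, e, b, by omega, h, hb, by omega⟩)
  · by_cases h2 : b = e
    · rcases lt_trichotomy a d with h | h | h
      · exact Or.inr (Or.inr ⟨a, d, b, h, by omega, hb, by omega⟩)
      · exact absurd h h1
      · exact Or.inr (Or.inr ⟨d, a, b, h, hab, hb, by omega⟩)
    · by_cases h3 : b = d
      · exact Or.inr (Or.inr ⟨a, b, e, hab, by omega, he, by omega⟩)
      · by_cases h4 : a = e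
        · exact Or.inr (Or.inr ⟨d, a, b, by omega, hab, hb, by omega⟩)
        · exact Or.inr (Or.inl ⟨h1, h4, h3, h2⟩)

/-- Three index pairs are the edges of a triangle. -/
def Tri (N a b d e f g : ℕ) : Prop :=
  ∃ x y z, x < y ∧ y < z ∧ z ≤ N ∧
    ((a = x ∧ b = y ∧ d = x ∧ e = z ∧ f = y ∧ g = z) ∨
     (a = x ∧ b = z ∧ d = x ∧ e = y ∧ f = y ∧ g = z) ∨
     (a = x ∧ b = y ∧ d = y ∧ e = z ∧ f = x ∧ g = z) ∨
     (a = y ∧ b = z ∧ d = x ∧ e = y ∧ f = x ∧ g = z) ∨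
     (a = x ∧ b = z ∧ d = y ∧ e = z ∧ f = x ∧ g = y) ∨
     (a = y ∧ b = z ∧ d = x ∧ e = z ∧ f = x ∧ g = y))

theorem Tri.rot {N a b d e f g : ℕ} (h : Tri N a b d e f g) : Tri N d e f g a b := by
  obtain ⟨x, y, z, h1, h2, h3, h⟩ := h
  refine ⟨x, y, z, h1, h2, h3, ?_⟩
  rcases h with h | h | h | h | h | h <;> obtain ⟨rfl, rfl, rfl, rfl, rfl, rfl⟩ := h <;> simp

theorem Tri.swap {N a b d e f g : ℕ} (h : Tri N a b d e f g) : Tri N a b f g d e := by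
  obtain ⟨x, y, z, h1, h2, h3, h⟩ := h
  refine ⟨x, y, z, h1, h2, h3, ?_⟩
  rcases h with h | h | h | h | h | h <;> obtain ⟨rfl, rfl, rfl, rfl, rfl, rfl⟩ := h <;> simp

set_option maxHeartbeats 1000000 in
theorem core {L : Type*} [LieRing L] [LieAlgebra ℝ L]
    (N : ℕ) (ω : ℕ → ℝ) (J M : ℕ → ℕ → L) (B : ℕ → L)
    (hbr : SUBrackets N ω J M B)
    (hspan : ⊤ ≤ Submodule.span ℝ (Set.range (suFam N J M B)))
    (ξ : L →ₗ[ℝ] L →ₗ[ℝ] ℝ) (halt : ∀ x, ξ x x = 0) (A : ℕ → ℕ → ℝ)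
    (hA : ∀ a b c, a < b → b < c → c ≤ N → A a c = ckW ω b c * A a b + ckW ω a b * A b c)
    (hJJ : ∀ a b d e, a < b → b ≤ N → d < e → e ≤ N → ξ (J a b) (J d e) = 0)
    (hMM : ∀ a b d e, a < b → b ≤ N → d < e → e ≤ N → ξ (M a b) (M d e) = 0)
    (hJM0 : ∀ a b d e, a < b → b ≤ N → d < e → e ≤ N → ¬ (a = d ∧ b = e) →
      ξ (J a b) (M d e) = 0)
    (hJM1 : ∀ a b, a < b → b ≤ N → ξ (J a b) (M a b) = A a b)
    (hJB : ∀ a b l, a < b → b ≤ N → 1 ≤ l → l ≤ N → ξ (J a b) (B l) = 0)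
    (hMB : ∀ a b l, a < b → b ≤ N → 1 ≤ l → l ≤ N → ξ (M a b) (B l) = 0)
    (hBB : ∀ a b s l, a < s → s ≤ b → b ≤ N → 1 ≤ l → l ≤ N →
      ckW ω a b * ξ (B s) (B l) = 0) :
    IsLieCocycle ξ := by
  have hanti : ∀ x y, ξ x y = - ξ y x := by
    intro x y
    have h := halt (x + y)
    simp only [map_add, LinearMap.add_apply, halt] at h
    linarith
  have hBJ : ∀ a b l, a < b → b ≤ N → 1 ≤ l → l ≤ N → ξ (B l) (J a b) = 0 := by
    intro a b l h1 h2 h3 h4; rw [hanti, hJB a b l h1 h2 h3 h4, neg_zero]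
  have hBM : ∀ a b l, a < b → b ≤ N → 1 ≤ l → l ≤ N → ξ (B l) (M a b) = 0 := by
    intro a b l h1 h2 h3 h4; rw [hanti, hMB a b l h1 h2 h3 h4, neg_zero]
  have hMJ0 : ∀ a b d e, a < b → b ≤ N → d < e → e ≤ N → ¬ (a = d ∧ b = e) →
      ξ (M a b) (J d e) = 0 := by
    intro a b d e h1 h2 h3 h4 h5
    rw [hanti, hJM0 d e a b h3 h4 h1 h2 (by omega), neg_zero]
  have hMJ1 : ∀ a b, a < b → b ≤ N → ξ (M a b) (J a b) = - A a b := by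
    intro a b h1 h2; rw [hanti, hJM1 a b h1 h2]
  -- brackets in swapped order
  have sk : ∀ x y : L, ⁅x, y⁆ = -⁅y, x⁆ := fun x y => (lie_skew x y).symm
  -- brackets evaluated by ξ against something
  -- [J,J] : any functional killing the third edge's J kills the bracket
  have bJJ : ∀ a b d e, a < b → b ≤ N → d < e → e ≤ N → ∀ φ : L →ₗ[ℝ] ℝ,
      (∀ f g, f < g → g ≤ N → Tri N a b d e f g → φ (J f g) = 0) → φ ⁅J a b, J d e⁆ = 0 := by
    intro a b d e h1 h2 h3 h4 φ hφ
    rcases pair_cases N a b d e h1 h2 h3 h4 with ⟨rfl, rfl⟩ | ⟨n1, n2, n3, n4⟩ |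
      ⟨x, y, z, hx, hy, hz, h | h | h | h | h | h⟩
    · simp
    · rw [hbr.jj_disj a b d e h1 h2 h3 h4 n1 n2 n3 n4, map_zero]
    all_goals obtain ⟨rfl, rfl, rfl, rfl⟩ := h
    · rw [hbr.jj_left _ _ _ hx hy hz, map_smul, hφ _ _ hy hz ⟨_, _, _, hx, hy, hz, by simp⟩,
        smul_zero]
    · rw [sk, hbr.jj_left _ _ _ hx hy hz, map_neg, map_smul,
        hφ _ _ hy hz ⟨_, _, _, hx, hy, hz, by simp⟩, smul_zero, neg_zero]
    · rw [hbr.jj_mid _ _ _ hx hy hz, map_neg,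
        hφ _ _ (hx.trans hy) hz ⟨_, _, _, hx, hy, hz, by simp⟩, neg_zero]
    · rw [sk, hbr.jj_mid _ _ _ hx hy hz, neg_neg,
        hφ _ _ (hx.trans hy) hz ⟨_, _, _, hx, hy, hz, by simp⟩]
    · rw [hbr.jj_right _ _ _ hx hy hz, map_smul,
        hφ _ _ hx (by omega) ⟨_, _, _, hx, hy, hz, by simp⟩, smul_zero]
    · rw [sk, hbr.jj_right _ _ _ hx hy hz, map_neg, map_smul,
        hφ _ _ hx (by omega) ⟨_, _, _, hx, hy, hz, by simp⟩, smul_zero, neg_zero]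
  have bMM : ∀ a b d e, a < b → b ≤ N → d < e → e ≤ N → ∀ φ : L →ₗ[ℝ] ℝ,
      (∀ f g, f < g → g ≤ N → Tri N a b d e f g → φ (J f g) = 0) → φ ⁅M a b, M d e⁆ = 0 := by
    intro a b d e h1 h2 h3 h4 φ hφ
    rcases pair_cases N a b d e h1 h2 h3 h4 with ⟨rfl, rfl⟩ | ⟨n1, n2, n3, n4⟩ |
      ⟨x, y, z, hx, hy, hz, h | h | h | h | h | h⟩
    · simp
    · rw [hbr.mm_disj a b d e h1 h2 h3 h4 n1 n2 n3 n4, map_zero]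
    all_goals obtain ⟨rfl, rfl, rfl, rfl⟩ := h
    · rw [hbr.mm_left _ _ _ hx hy hz, map_smul, hφ _ _ hy hz ⟨_, _, _, hx, hy, hz, by simp⟩,
        smul_zero]
    · rw [sk, hbr.mm_left _ _ _ hx hy hz, map_neg, map_smul,
        hφ _ _ hy hz ⟨_, _, _, hx, hy, hz, by simp⟩, smul_zero, neg_zero]
    · rw [hbr.mm_mid _ _ _ hx hy hz,
        hφ _ _ (hx.trans hy) hz ⟨_, _, _, hx, hy, hz, by simp⟩]
    · rw [sk, hbr.mm_mid _ _ _ hx hy hz, map_neg,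
        hφ _ _ (hx.trans hy) hz ⟨_, _, _, hx, hy, hz, by simp⟩, neg_zero]
    · rw [hbr.mm_right _ _ _ hx hy hz, map_smul,
        hφ _ _ hx (by omega) ⟨_, _, _, hx, hy, hz, by simp⟩, smul_zero]
    · rw [sk, hbr.mm_right _ _ _ hx hy hz, map_neg, map_smul,
        hφ _ _ hx (by omega) ⟨_, _, _, hx, hy, hz, by simp⟩, smul_zero, neg_zero]
  have bJM' : ∀ a b d e, a < b → b ≤ N → d < e → e ≤ N → ¬ (a = d ∧ b = e) → ∀ φ : L →ₗ[ℝ] ℝ,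
      (∀ f g, f < g → g ≤ N → Tri N a b d e f g → φ (M f g) = 0) → φ ⁅J a b, M d e⁆ = 0 := by
    intro a b d e h1 h2 h3 h4 hne φ hφ
    rcases pair_cases N a b d e h1 h2 h3 h4 with h | ⟨n1, n2, n3, n4⟩ |
      ⟨x, y, z, hx, hy, hz, h | h | h | h | h | h⟩
    · exact absurd h hne
    · rw [hbr.jm_disj a b d e h1 h2 h3 h4 n1 n2 n3 n4, map_zero]
    all_goals obtain ⟨rfl, rfl, rfl, rfl⟩ := h
    · rw [hbr.jm_left _ _ _ hx hy hz, map_smul, hφ _ _ hy hz ⟨_, _, _, hx, hy, hz, by simp⟩,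
        smul_zero]
    · rw [sk, hbr.mj_left _ _ _ hx hy hz, map_neg, map_neg, map_smul,
        hφ _ _ hy hz ⟨_, _, _, hx, hy, hz, by simp⟩, smul_zero, neg_zero, neg_zero]
    · rw [hbr.jm_mid _ _ _ hx hy hz, map_neg,
        hφ _ _ (hx.trans hy) hz ⟨_, _, _, hx, hy, hz, by simp⟩, neg_zero]
    · rw [sk, hbr.mj_mid _ _ _ hx hy hz, neg_neg,
        hφ _ _ (hx.trans hy) hz ⟨_, _, _, hx, hy, hz, by simp⟩]
    · rw [hbr.jm_right _ _ _ hx hy hz, map_neg, map_smul,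
        hφ _ _ hx (by omega) ⟨_, _, _, hx, hy, hz, by simp⟩, smul_zero, neg_zero]
    · rw [sk, hbr.mj_right _ _ _ hx hy hz, map_neg, map_smul,
        hφ _ _ hx (by omega) ⟨_, _, _, hx, hy, hz, by simp⟩, smul_zero, neg_zero]
  have bJM : ∀ a b d e, a < b → b ≤ N → d < e → e ≤ N → ∀ φ : L →ₗ[ℝ] ℝ,
      (∀ f g, f < g → g ≤ N → Tri N a b d e f g → φ (M f g) = 0) →
      (∀ l, 1 ≤ l → l ≤ N → φ (B l) = 0) → φ ⁅J a b, M d e⁆ = 0 := by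
    intro a b d e h1 h2 h3 h4 φ hφ hB
    by_cases hne : a = d ∧ b = e
    · obtain ⟨rfl, rfl⟩ := hne
      rw [hbr.jm_same a b h1 h2, map_smul, map_sum, Finset.sum_eq_zero, smul_zero]
      intro s hs
      rw [Finset.mem_Icc] at hs
      exact hB s (by omega) (by omega)
    · exact bJM' a b d e h1 h2 h3 h4 hne φ hφ
  have flipv : ∀ x y z : L, ξ.flip z ⁅x, y⁆ = ξ ⁅x, y⁆ z := fun _ _ _ => rfl
  have bBB : ∀ k l, 1 ≤ k → k ≤ N → 1 ≤ l → l ≤ N → ⁅B k, B l⁆ = 0 := by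
    intro k l h1 h2 h3 h4
    rcases lt_trichotomy k l with h | h | h
    · exact hbr.bb k l h1 h h4
    · rw [h, lie_self]
    · rw [sk, hbr.bb l k h3 h h2, neg_zero]
  -- the cyclic sum
  let D : L → L → L → ℝ := fun x y z => ξ ⁅x, y⁆ z + ξ ⁅y, z⁆ x + ξ ⁅z, x⁆ y
  have Drot : ∀ x y z, D x y z = D y z x := by intro x y z; simp only [D]; ring
  have Dsw : ∀ x y z, D x y z = - D y x z := by
    intro x y z
    simp only [D]
    rw [sk y x, sk x z, sk z y]
    simp only [map_neg, LinearMap.neg_apply]; ring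
  have DBBB : ∀ k l m, 1 ≤ k → k ≤ N → 1 ≤ l → l ≤ N → 1 ≤ m → m ≤ N →
      D (B k) (B l) (B m) = 0 := by
    intro k l m h1 h2 h3 h4 h5 h6
    simp only [D]
    rw [bBB k l h1 h2 h3 h4, bBB l m h3 h4 h5 h6, bBB m k h5 h6 h1 h2]; simp
  have DJBB : ∀ a b k l, a < b → b ≤ N → 1 ≤ k → k ≤ N → 1 ≤ l → l ≤ N →
      D (J a b) (B k) (B l) = 0 := by
    intro a b k l h1 h2 h3 h4 h5 h6
    simp only [D]
    rw [bBB k l h3 h4 h5 h6, sk (B l), hbr.jb a b k h1 h2 h3 h4, hbr.jb a b l h1 h2 h5 h6]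
    simp [hMB a b l h1 h2 h5 h6, hMB a b k h1 h2 h3 h4]
  have DMBB : ∀ a b k l, a < b → b ≤ N → 1 ≤ k → k ≤ N → 1 ≤ l → l ≤ N →
      D (M a b) (B k) (B l) = 0 := by
    intro a b k l h1 h2 h3 h4 h5 h6
    simp only [D]
    rw [bBB k l h3 h4 h5 h6, sk (B l), hbr.mb a b k h1 h2 h3 h4, hbr.mb a b l h1 h2 h5 h6]
    simp [hJB a b l h1 h2 h5 h6, hJB a b k h1 h2 h3 h4]
  have DJJB : ∀ a b d e l, a < b → b ≤ N → d < e → e ≤ N → 1 ≤ l → l ≤ N →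
      D (J a b) (J d e) (B l) = 0 := by
    intro a b d e l h1 h2 h3 h4 h5 h6
    have t1 : ξ ⁅J a b, J d e⁆ (B l) = 0 := by
      rw [← flipv]
      exact bJJ a b d e h1 h2 h3 h4 _ fun f g hf hg _ => hJB f g l hf hg h5 h6
    simp only [D]
    rw [t1, sk (B l), hbr.jb a b l h1 h2 h5 h6, hbr.jb d e l h3 h4 h5 h6]
    by_cases h : a = d ∧ b = e
    · obtain ⟨rfl, rfl⟩ := h
      simp
    · simp [hMJ0 a b d e h1 h2 h3 h4 h, hMJ0 d e a b h3 h4 h1 h2 (by omega)]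
  have DMMB : ∀ a b d e l, a < b → b ≤ N → d < e → e ≤ N → 1 ≤ l → l ≤ N →
      D (M a b) (M d e) (B l) = 0 := by
    intro a b d e l h1 h2 h3 h4 h5 h6
    have t1 : ξ ⁅M a b, M d e⁆ (B l) = 0 := by
      rw [← flipv]
      exact bMM a b d e h1 h2 h3 h4 _ fun f g hf hg _ => hJB f g l hf hg h5 h6
    simp only [D]
    rw [t1, sk (B l), hbr.mb a b l h1 h2 h5 h6, hbr.mb d e l h3 h4 h5 h6]
    by_cases h : a = d ∧ b = e
    · obtain ⟨rfl, rfl⟩ := h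
      simp
    · simp [hJM0 a b d e h1 h2 h3 h4 h, hJM0 d e a b h3 h4 h1 h2 (by omega)]
  have DJMB : ∀ a b d e l, a < b → b ≤ N → d < e → e ≤ N → 1 ≤ l → l ≤ N →
      D (J a b) (M d e) (B l) = 0 := by
    intro a b d e l h1 h2 h3 h4 h5 h6
    have t1 : ξ ⁅J a b, M d e⁆ (B l) = 0 := by
      by_cases h : a = d ∧ b = e
      · obtain ⟨rfl, rfl⟩ := h
        rw [hbr.jm_same a b h1 h2, map_smul, map_sum, LinearMap.smul_apply,
          LinearMap.sum_apply, smul_eq_mul, Finset.mul_sum]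
        apply Finset.sum_eq_zero
        intro s hs
        rw [Finset.mem_Icc] at hs
        have := hBB a b s l (by omega) hs.2 h2 h5 h6
        linear_combination (-2) * this
      · rw [← flipv]
        exact bJM' a b d e h1 h2 h3 h4 h _ fun f g hf hg _ => hMB f g l hf hg h5 h6
    simp only [D]
    rw [t1, sk (B l), hbr.jb a b l h1 h2 h5 h6, hbr.mb d e l h3 h4 h5 h6]
    simp [hJJ d e a b h3 h4 h1 h2, hMM a b d e h1 h2 h3 h4]
  have DJJJ : ∀ a b d e f g, a < b → b ≤ N → d < e → e ≤ N → f < g → g ≤ N →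
      D (J a b) (J d e) (J f g) = 0 := by
    intro a b d e f g h1 h2 h3 h4 h5 h6
    have key : ∀ a b d e f g, a < b → b ≤ N → d < e → e ≤ N → f < g → g ≤ N →
        ξ ⁅J a b, J d e⁆ (J f g) = 0 := by
      intro a b d e f g h1 h2 h3 h4 h5 h6
      rw [← flipv]
      exact bJJ a b d e h1 h2 h3 h4 _ fun s t hs ht _ => hJJ s t f g hs ht h5 h6
    simp only [D]
    rw [key a b d e f g h1 h2 h3 h4 h5 h6, key d e f g a b h3 h4 h5 h6 h1 h2,
      key f g a b d e h5 h6 h1 h2 h3 h4]; simp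
  have DJMM : ∀ a b d e f g, a < b → b ≤ N → d < e → e ≤ N → f < g → g ≤ N →
      D (J a b) (M d e) (M f g) = 0 := by
    intro a b d e f g h1 h2 h3 h4 h5 h6
    have k1 : ∀ a b d e f g, a < b → b ≤ N → d < e → e ≤ N → f < g → g ≤ N →
        ξ ⁅J a b, M d e⁆ (M f g) = 0 := by
      intro a b d e f g h1 h2 h3 h4 h5 h6
      rw [← flipv]
      exact bJM a b d e h1 h2 h3 h4 _ (fun s t hs ht _ => hMM s t f g hs ht h5 h6)
        fun l hl hl' => hBM f g l h5 h6 hl hl'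
    have k2 : ξ ⁅M d e, M f g⁆ (J a b) = 0 := by
      rw [← flipv]
      exact bMM d e f g h3 h4 h5 h6 _ fun s t hs ht _ => hJJ s t a b hs ht h1 h2
    simp only [D]
    rw [k1 a b d e f g h1 h2 h3 h4 h5 h6, k2, sk (M f g), map_neg, LinearMap.neg_apply,
      k1 a b f g d e h1 h2 h5 h6 h3 h4]; simp
  have DMMM : ∀ a b d e f g, a < b → b ≤ N → d < e → e ≤ N → f < g → g ≤ N →
      D (M a b) (M d e) (M f g) = 0 := by
    intro a b d e f g h1 h2 h3 h4 h5 h6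
    by_cases hT : Tri N a b d e f g
    · have base : ∀ x y z, x < y → y < z → z ≤ N → D (M x y) (M y z) (M x z) = 0 := by
        intro x y z hx hy hz
        simp only [D]
        rw [hbr.mm_mid x y z hx hy hz, sk (M y z), hbr.mm_right x y z hx hy hz, sk (M x z),
          hbr.mm_left x y z hx hy hz]
        simp only [map_neg, map_smul, LinearMap.neg_apply, LinearMap.smul_apply, smul_eq_mul]
        rw [hJM1 x z (by omega) hz, hJM1 x y hx (by omega), hJM1 y z hy hz,
          hA x y z hx hy hz]
        ring
      obtain ⟨x, y, z, hx, hy, hz, h | h | h | h | h | h⟩ := hT <;>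
        obtain ⟨rfl, rfl, rfl, rfl, rfl, rfl⟩ := h <;>
        have hb := base _ _ _ hx hy hz
      · rw [Dsw, Drot, hb, neg_zero]
      · rw [Drot, hb]
      · exact hb
      · rw [Dsw, hb, neg_zero]
      · rw [Dsw, Drot, Drot, hb, neg_zero]
      · rw [Drot, Drot, hb]
    · have key : ∀ a b d e f g, a < b → b ≤ N → d < e → e ≤ N → f < g → g ≤ N →
          ¬ Tri N a b d e f g → ξ ⁅M a b, M d e⁆ (M f g) = 0 := by
        intro a b d e f g h1 h2 h3 h4 h5 h6 hT
        rw [← flipv]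
        refine bMM a b d e h1 h2 h3 h4 _ fun s t hs ht hT' => hJM0 s t f g hs ht h5 h6 ?_
        rintro ⟨rfl, rfl⟩
        exact hT hT'
      simp only [D]
      rw [key a b d e f g h1 h2 h3 h4 h5 h6 hT,
        key d e f g a b h3 h4 h5 h6 h1 h2 (fun h => hT h.rot.rot),
        key f g a b d e h5 h6 h1 h2 h3 h4 (fun h => hT h.rot)]; simp
  have DJJM : ∀ a b d e f g, a < b → b ≤ N → d < e → e ≤ N → f < g → g ≤ N →
      D (J a b) (J d e) (M f g) = 0 := by
    intro a b d e f g h1 h2 h3 h4 h5 h6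
    by_cases hT : Tri N a b d e f g
    · have base1 : ∀ x y z, x < y → y < z → z ≤ N → D (J x y) (J y z) (M x z) = 0 := by
        intro x y z hx hy hz
        simp only [D]
        rw [hbr.jj_mid x y z hx hy hz, sk (J y z), hbr.mj_right x y z hx hy hz, sk (M x z),
          hbr.jm_left x y z hx hy hz]
        simp only [map_neg, map_smul, LinearMap.neg_apply, LinearMap.smul_apply, smul_eq_mul]
        rw [hJM1 x z (by omega) hz, hMJ1 x y hx (by omega), hMJ1 y z hy hz,
          hA x y z hx hy hz]
        ring
      have base2 : ∀ x y z, x < y → y < z → z ≤ N → D (J x y) (J x z) (M y z) = 0 := by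
        intro x y z hx hy hz
        simp only [D]
        rw [hbr.jj_left x y z hx hy hz, hbr.jm_right x y z hx hy hz, sk (M y z),
          hbr.jm_mid x y z hx hy hz]
        simp only [map_neg, map_smul, LinearMap.neg_apply, LinearMap.smul_apply, smul_eq_mul]
        rw [hMJ1 x z (by omega) hz, hMJ1 x y hx (by omega), hJM1 y z hy hz,
          hA x y z hx hy hz]
        ring
      have base3 : ∀ x y z, x < y → y < z → z ≤ N → D (J x z) (J y z) (M x y) = 0 := by
        intro x y z hx hy hz
        simp only [D]
        rw [hbr.jj_right x y z hx hy hz, sk (J y z), hbr.mj_mid x y z hx hy hz,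
          hbr.mj_left x y z hx hy hz]
        simp only [map_neg, map_smul, LinearMap.neg_apply, LinearMap.smul_apply, smul_eq_mul]
        rw [hMJ1 x z (by omega) hz, hJM1 x y hx (by omega), hMJ1 y z hy hz,
          hA x y z hx hy hz]
        ring
      obtain ⟨x, y, z, hx, hy, hz, h | h | h | h | h | h⟩ := hT <;>
        obtain ⟨rfl, rfl, rfl, rfl, rfl, rfl⟩ := h
      · exact base2 _ _ _ hx hy hz
      · rw [Dsw, base2 _ _ _ hx hy hz, neg_zero]
      · exact base1 _ _ _ hx hy hz
      · rw [Dsw, base1 _ _ _ hx hy hz, neg_zero]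
      · exact base3 _ _ _ hx hy hz
      · rw [Dsw, base3 _ _ _ hx hy hz, neg_zero]
    · have t1 : ξ ⁅J a b, J d e⁆ (M f g) = 0 := by
        rw [← flipv]
        refine bJJ a b d e h1 h2 h3 h4 _ fun s t hs ht hT' => hJM0 s t f g hs ht h5 h6 ?_
        rintro ⟨rfl, rfl⟩
        exact hT hT'
      have t2 : ξ ⁅J d e, M f g⁆ (J a b) = 0 := by
        rw [← flipv]
        refine bJM d e f g h3 h4 h5 h6 _ (fun s t hs ht hT' => hMJ0 s t a b hs ht h1 h2 ?_)
          fun l hl hl' => hBJ a b l h1 h2 hl hl'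
        rintro ⟨rfl, rfl⟩
        exact hT hT'.rot.rot
      have t3 : ξ ⁅J a b, M f g⁆ (J d e) = 0 := by
        rw [← flipv]
        refine bJM a b f g h1 h2 h5 h6 _ (fun s t hs ht hT' => hMJ0 s t d e hs ht h3 h4 ?_)
          fun l hl hl' => hBJ d e l h3 h4 hl hl'
        rintro ⟨rfl, rfl⟩
        exact hT hT'.swap
      simp only [D]
      rw [t1, t2, sk (M f g), map_neg, LinearMap.neg_apply, t3]; simp
  -- all basis triples
  have Dbasis : ∀ i j k : SUIdx N,
      D (suFam N J M B i) (suFam N J M B j) (suFam N J M B k) = 0 := by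
    rintro ⟨(⟨a, b⟩ | ⟨a, b⟩ | k), h1⟩ ⟨(⟨d, e⟩ | ⟨d, e⟩ | l), h2⟩ ⟨(⟨f, g⟩ | ⟨f, g⟩ | m), h3⟩ <;>
      obtain ⟨p1, p2⟩ := h1 <;> obtain ⟨q1, q2⟩ := h2 <;> obtain ⟨r1, r2⟩ := h3 <;>
      simp only [suFam]
    · exact DJJJ a b d e f g p1 p2 q1 q2 r1 r2
    · exact DJJM a b d e f g p1 p2 q1 q2 r1 r2
    · exact DJJB a b d e m p1 p2 q1 q2 r1 r2
    · rw [Drot, Drot]; exact DJJM f g a b d e r1 r2 p1 p2 q1 q2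
    · exact DJMM a b d e f g p1 p2 q1 q2 r1 r2
    · exact DJMB a b d e m p1 p2 q1 q2 r1 r2
    · rw [Drot, Drot]; exact DJJB f g a b l r1 r2 p1 p2 q1 q2
    · rw [Dsw, Drot, DJMB a b f g l p1 p2 r1 r2 q1 q2, neg_zero]
    · exact DJBB a b l m p1 p2 q1 q2 r1 r2
    · rw [Drot]; exact DJJM d e f g a b q1 q2 r1 r2 p1 p2
    · rw [Drot]; exact DJMM d e f g a b q1 q2 r1 r2 p1 p2
    · rw [Dsw, DJMB d e a b m q1 q2 p1 p2 r1 r2, neg_zero]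
    · rw [Drot, Drot]; exact DJMM f g a b d e r1 r2 p1 p2 q1 q2
    · exact DMMM a b d e f g p1 p2 q1 q2 r1 r2
    · exact DMMB a b d e m p1 p2 q1 q2 r1 r2
    · rw [Drot, Drot]; exact DJMB f g a b l r1 r2 p1 p2 q1 q2
    · rw [Drot, Drot]; exact DMMB f g a b l r1 r2 p1 p2 q1 q2
    · exact DMBB a b l m p1 p2 q1 q2 r1 r2
    · rw [Drot]; exact DJJB d e f g k q1 q2 r1 r2 p1 p2
    · rw [Drot]; exact DJMB d e f g k q1 q2 r1 r2 p1 p2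
    · rw [Drot]; exact DJBB d e m k q1 q2 r1 r2 p1 p2
    · rw [Drot, Dsw, DJMB f g d e k r1 r2 q1 q2 p1 p2, neg_zero]
    · rw [Drot]; exact DMMB d e f g k q1 q2 r1 r2 p1 p2
    · rw [Drot]; exact DMBB d e m k q1 q2 r1 r2 p1 p2
    · rw [Drot, Drot]; exact DJBB f g k l r1 r2 p1 p2 q1 q2
    · rw [Drot, Drot]; exact DMBB f g k l r1 r2 p1 p2 q1 q2
    · exact DBBB k l m p1 p2 q1 q2 r1 r2
  refine ⟨halt, ?_⟩
  have ext1 : ∀ y z, (∀ i, D (suFam N J M B i) y z = 0) → ∀ x, D x y z = 0 := by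
    intro y z h x
    have hx : x ∈ Submodule.span ℝ (Set.range (suFam N J M B)) := hspan trivial
    induction hx using Submodule.span_induction with
    | mem x hx => obtain ⟨i, rfl⟩ := hx; exact h i
    | zero => simp [D]
    | add u v _ _ hu hv =>
      simp only [D, add_lie, lie_add, map_add, LinearMap.add_apply] at hu hv ⊢
      linarith
    | smul c u _ hu =>
      simp only [D, smul_lie, lie_smul, map_smul, LinearMap.smul_apply, smul_eq_mul] at hu ⊢
      linear_combination c * hu
  intro x y z
  change D x y z = 0
  refine ext1 y z (fun i => ?_) x
  rw [Drot]
  refine ext1 z _ (fun j => ?_) y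
  rw [Drot]
  refine ext1 _ _ (fun k => ?_) z
  exact Dbasis k i j

theorem ckW_mul (ω : ℕ → ℝ) (a b c : ℕ) (h1 : a ≤ b) (h2 : b ≤ c) :
    ckW ω a b * ckW ω b c = ckW ω a c := by
  unfold ckW
  simp only [Finset.Icc_add_one_left_eq_Ioc]
  exact Finset.prod_Ioc_consecutive ω h1 h2

theorem ckA_rec (ω α : ℕ → ℝ) (a b c : ℕ) (h1 : a < b) (h2 : b < c) :
    ∑ s ∈ Finset.Icc (a + 1) c, ckW ω a (s - 1) * ckW ω s c * α s =
      ckW ω b c * ∑ s ∈ Finset.Icc (a + 1) b, ckW ω a (s - 1) * ckW ω s b * α s +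
      ckW ω a b * ∑ s ∈ Finset.Icc (b + 1) c, ckW ω b (s - 1) * ckW ω s c * α s := by
  simp only [Finset.Icc_add_one_left_eq_Ioc]
  rw [← Finset.sum_Ioc_consecutive _ h1.le h2.le, Finset.mul_sum, Finset.mul_sum]
  congr 1
  · refine Finset.sum_congr rfl fun s hs => ?_
    rw [Finset.mem_Ioc] at hs
    rw [← ckW_mul ω s b c hs.2 h2.le]; ring
  · refine Finset.sum_congr rfl fun s hs => ?_
    rw [Finset.mem_Ioc] at hs
    rw [← ckW_mul ω a b (s - 1) h1.le (by omega)]; ring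

theorem su_cocycle_converse {L : Type*} [LieRing L] [LieAlgebra ℝ L]
    (N : ℕ) (hN : 1 ≤ N) (ω : ℕ → ℝ) (J M : ℕ → ℕ → L) (B : ℕ → L)
    (hbr : SUBrackets N ω J M B) (hbasis : SUBasis N J M B)
    (η τ : ℕ → ℕ → ℝ) (α : ℕ → ℝ) (β : ℕ → ℕ → ℝ)
    (hβ : (∀ k l, 1 ≤ k → k < l → l ≤ N → ω k * β k l = 0 ∧ ω l * β k l = 0))
    (ξ : L →ₗ[ℝ] L →ₗ[ℝ] ℝ) (halt : ∀ x, ξ x x = 0)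
    (hv1 : (∀ a b c, a < b → b < c → c ≤ N →
        ξ (J a b) (J a c) = ckW ω a b * η b c ∧
        ξ (M a b) (M a c) = ckW ω a b * η b c ∧
        ξ (J a b) (J b c) = -(η a c) ∧
        ξ (M a b) (M b c) = η a c ∧
        ξ (J a c) (J b c) = ckW ω b c * η a b ∧
        ξ (M a c) (M b c) = ckW ω b c * η a b ∧
        ξ (J a b) (M a c) = ckW ω a b * τ b c ∧
        ξ (M a b) (J a c) = -(ckW ω a b * τ b c) ∧
        ξ (J a b) (M b c) = -(τ a c) ∧
        ξ (M a b) (J b c) = -(τ a c) ∧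
        ξ (J a c) (M b c) = -(ckW ω b c * τ a b) ∧
        ξ (M a c) (J b c) = ckW ω b c * τ a b))
    (hv2 : (∀ a b d e, a < b → b ≤ N → d < e → e ≤ N → a ≠ d → a ≠ e → b ≠ d → b ≠ e →
        ξ (J a b) (J d e) = 0 ∧ ξ (M a b) (M d e) = 0 ∧ ξ (J a b) (M d e) = 0))
    (hv3 : (∀ a b l, a < b → b ≤ N → 1 ≤ l → l ≤ N →
        ξ (J a b) (B l) = ckKappa a b l * τ a b ∧
        ξ (M a b) (B l) = -(ckKappa a b l * η a b)))
    (hv4 : (∀ a b, a < b → b ≤ N →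
        ξ (J a b) (M a b) = ∑ s ∈ Finset.Icc (a + 1) b, ckW ω a (s - 1) * ckW ω s b * α s))
    (hv5 : (∀ k l, 1 ≤ k → k < l → l ≤ N → ξ (B k) (B l) = β k l)) :
    IsLieCocycle ξ := by
  classical
  let bas := Module.Basis.mk hbasis.1 hbasis.2
  have hbas : ∀ i : SUIdx N, bas i = suFam N J M B i :=
    fun i => Module.Basis.mk_apply hbasis.1 hbasis.2 i
  let μ : L →ₗ[ℝ] ℝ := bas.constr ℝ (fun i : SUIdx N =>
    match i.1 with
    | Sum.inl (a, b) => η a b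
    | Sum.inr (Sum.inl (a, b)) => τ a b
    | Sum.inr (Sum.inr _) => 0)
  have hμ : ∀ i : SUIdx N, μ (suFam N J M B i) =
      match i.1 with
      | Sum.inl (a, b) => η a b
      | Sum.inr (Sum.inl (a, b)) => τ a b
      | Sum.inr (Sum.inr _) => 0 := by
    intro i
    rw [← hbas i]
    exact bas.constr_basis ℝ _ i
  have hμJ : ∀ a b, a < b → b ≤ N → μ (J a b) = η a b :=
    fun a b h1 h2 => hμ ⟨Sum.inl (a, b), h1, h2⟩
  have hμM : ∀ a b, a < b → b ≤ N → μ (M a b) = τ a b :=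
    fun a b h1 h2 => hμ ⟨Sum.inr (Sum.inl (a, b)), h1, h2⟩
  have hμB : ∀ l, 1 ≤ l → l ≤ N → μ (B l) = 0 :=
    fun l h1 h2 => hμ ⟨Sum.inr (Sum.inr l), h1, h2⟩
  clear_value μ
  let c : L →ₗ[ℝ] L →ₗ[ℝ] ℝ := LinearMap.mk₂ ℝ (fun x y => μ ⁅x, y⁆)
    (by intros; simp) (by intros; simp) (by intros; simp) (by intros; simp)
  have hc : ∀ x y, c x y = μ ⁅x, y⁆ := fun _ _ => rfl
  clear_value c
  have hd : ∀ x y, (ξ - c) x y = ξ x y - μ ⁅x, y⁆ := by intro x y; simp [hc]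
  have halt' : ∀ x, (ξ - c) x x = 0 := by intro x; rw [hd, halt, lie_self, map_zero, sub_zero]
  have hanti : ∀ x y, (ξ - c) x y = - (ξ - c) y x := by
    intro x y
    have h := halt' (x + y)
    simp only [map_add, LinearMap.add_apply, halt'] at h
    linarith
  have hξanti : ∀ x y, ξ x y = - ξ y x := by
    intro x y
    have h := halt (x + y)
    simp only [map_add, LinearMap.add_apply, halt] at h
    linarith
  have key : IsLieCocycle (ξ - c) := by
    refine core N ω J M B hbr hbasis.2 (ξ - c) halt'
      (fun a b => ∑ s ∈ Finset.Icc (a + 1) b, ckW ω a (s - 1) * ckW ω s b * α s)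
      (fun a b c h1 h2 _ => ckA_rec ω α a b c h1 h2) ?_ ?_ ?_ ?_ ?_ ?_ ?_
    · intro a b d e h1 h2 h3 h4
      rcases pair_cases N a b d e h1 h2 h3 h4 with ⟨rfl, rfl⟩ | ⟨n1, n2, n3, n4⟩ |
        ⟨x, y, z, hx, hy, hz, h | h | h | h | h | h⟩
      · exact halt' _
      · rw [hd, hbr.jj_disj a b d e h1 h2 h3 h4 n1 n2 n3 n4,
          (hv2 a b d e h1 h2 h3 h4 n1 n2 n3 n4).1]; simp
      all_goals
        obtain ⟨rfl, rfl, rfl, rfl⟩ := h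
        obtain ⟨v1, v2, v3, v4, v5, v6, v7, v8, v9, v10, v11, v12⟩ := hv1 _ _ _ hx hy hz
      · rw [hd, hbr.jj_left _ _ _ hx hy hz, v1, map_smul, hμJ _ _ hy hz]; simp
      · rw [hanti, hd, hbr.jj_left _ _ _ hx hy hz, v1, map_smul, hμJ _ _ hy hz]; simp
      · rw [hd, hbr.jj_mid _ _ _ hx hy hz, v3, map_neg, hμJ _ _ (hx.trans hy) hz]; simp
      · rw [hanti, hd, hbr.jj_mid _ _ _ hx hy hz, v3, map_neg, hμJ _ _ (hx.trans hy) hz]; simp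
      · rw [hd, hbr.jj_right _ _ _ hx hy hz, v5, map_smul, hμJ _ _ hx (by omega)]; simp
      · rw [hanti, hd, hbr.jj_right _ _ _ hx hy hz, v5, map_smul, hμJ _ _ hx (by omega)]; simp
    · intro a b d e h1 h2 h3 h4
      rcases pair_cases N a b d e h1 h2 h3 h4 with ⟨rfl, rfl⟩ | ⟨n1, n2, n3, n4⟩ |
        ⟨x, y, z, hx, hy, hz, h | h | h | h | h | h⟩
      · exact halt' _
      · rw [hd, hbr.mm_disj a b d e h1 h2 h3 h4 n1 n2 n3 n4,
          (hv2 a b d e h1 h2 h3 h4 n1 n2 n3 n4).2.1]; simp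
      all_goals
        obtain ⟨rfl, rfl, rfl, rfl⟩ := h
        obtain ⟨v1, v2, v3, v4, v5, v6, v7, v8, v9, v10, v11, v12⟩ := hv1 _ _ _ hx hy hz
      · rw [hd, hbr.mm_left _ _ _ hx hy hz, v2, map_smul, hμJ _ _ hy hz]; simp
      · rw [hanti, hd, hbr.mm_left _ _ _ hx hy hz, v2, map_smul, hμJ _ _ hy hz]; simp
      · rw [hd, hbr.mm_mid _ _ _ hx hy hz, v4, hμJ _ _ (hx.trans hy) hz]; simp
      · rw [hanti, hd, hbr.mm_mid _ _ _ hx hy hz, v4, hμJ _ _ (hx.trans hy) hz]; simp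
      · rw [hd, hbr.mm_right _ _ _ hx hy hz, v6, map_smul, hμJ _ _ hx (by omega)]; simp
      · rw [hanti, hd, hbr.mm_right _ _ _ hx hy hz, v6, map_smul, hμJ _ _ hx (by omega)]; simp
    · intro a b d e h1 h2 h3 h4 hne
      rcases pair_cases N a b d e h1 h2 h3 h4 with h | ⟨n1, n2, n3, n4⟩ |
        ⟨x, y, z, hx, hy, hz, h | h | h | h | h | h⟩
      · exact absurd h hne
      · rw [hd, hbr.jm_disj a b d e h1 h2 h3 h4 n1 n2 n3 n4,
          (hv2 a b d e h1 h2 h3 h4 n1 n2 n3 n4).2.2]; simp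
      all_goals
        obtain ⟨rfl, rfl, rfl, rfl⟩ := h
        obtain ⟨v1, v2, v3, v4, v5, v6, v7, v8, v9, v10, v11, v12⟩ := hv1 _ _ _ hx hy hz
      · rw [hd, hbr.jm_left _ _ _ hx hy hz, v7, map_smul, hμM _ _ hy hz]; simp
      · rw [hanti, hd, hbr.mj_left _ _ _ hx hy hz, v8, map_neg, map_smul, hμM _ _ hy hz]; simp
      · rw [hd, hbr.jm_mid _ _ _ hx hy hz, v9, map_neg, hμM _ _ (hx.trans hy) hz]; simp
      · rw [hanti, hd, hbr.mj_mid _ _ _ hx hy hz, v10, map_neg, hμM _ _ (hx.trans hy) hz]; simp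
      · rw [hd, hbr.jm_right _ _ _ hx hy hz, v11, map_neg, map_smul, hμM _ _ hx (by omega)]
        simp
      · rw [hanti, hd, hbr.mj_right _ _ _ hx hy hz, v12, map_smul, hμM _ _ hx (by omega)]; simp
    · intro a b h1 h2
      rw [hd, hbr.jm_same a b h1 h2, hv4 a b h1 h2, map_smul, map_sum,
        Finset.sum_eq_zero (s := Finset.Icc (a + 1) b) (f := fun s => μ (B s))]
      · simp
      · intro s hs
        rw [Finset.mem_Icc] at hs
        exact hμB s (by omega) (by omega)
    · intro a b l h1 h2 h3 h4
      rw [hd, hbr.jb a b l h1 h2 h3 h4, (hv3 a b l h1 h2 h3 h4).1, map_smul, hμM a b h1 h2]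
      simp
    · intro a b l h1 h2 h3 h4
      rw [hd, hbr.mb a b l h1 h2 h3 h4, (hv3 a b l h1 h2 h3 h4).2, map_neg, map_smul,
        hμJ a b h1 h2]
      simp
    · intro a b s l h1 h2 h3 h4 h5
      have hW : ∃ r, ckW ω a b = r * ω s := by
        obtain ⟨r, hr⟩ := Finset.dvd_prod_of_mem ω
          (show s ∈ Finset.Icc (a + 1) b from Finset.mem_Icc.2 ⟨by omega, h2⟩)
        exact ⟨r, by unfold ckW; rw [hr, mul_comm]⟩
      obtain ⟨r, hr⟩ := hW
      rcases lt_trichotomy s l with h | h | h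
      · rw [hd, hbr.bb s l (by omega) h h5, hv5 s l (by omega) h h5, map_zero, sub_zero, hr]
        linear_combination r * (hβ s l (by omega) h h5).1
      · rw [h, halt', mul_zero]
      · rw [hanti, hd, hbr.bb l s h4 h (by omega), hv5 l s h4 h (by omega), map_zero, sub_zero, hr]
        linear_combination (-r) * (hβ l s h4 h (by omega)).2
  refine ⟨halt, fun x y z => ?_⟩
  have h := key.2 x y z
  simp only [hd] at h
  have hj : μ ⁅⁅x, y⁆, z⁆ + μ ⁅⁅y, z⁆, x⁆ + μ ⁅⁅z, x⁆, y⁆ = 0 := by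
    have e : ∀ u v : L, μ ⁅u, v⁆ = - μ ⁅v, u⁆ := by
      intro u v
      rw [← lie_skew, map_neg]
    have := congrArg μ (lie_jacobi x y z)
    rw [map_add, map_add, map_zero] at this
    rw [e _ z, e _ x, e _ y]
    linarith
  linarith
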